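/- arXiv:2508.06883 — 7 statements merged into one kernel-verified Lean document; each statement's English description precedes it below -/
import Mathlib

section
/- Let n ≥ 1 and let f : [0,∞) → ℝ be n times continuously differentiable, and suppose there exist Q > 0 and η > 0 such that |f^{(i)}(t)| ≤ Q·exp(t/η) for all t ≥ 0 and all 0 ≤ i ≤ n. Then for every u with 0 < u < η, the Sumudu transform of the n-th derivative satisfies S[f^{(n)}](u) = u^{−n}·(S[f](u) − Σ_{i=0}^{n−1} u^i · f^{(i)}(0)). -/
open MeasureTheory Real Set

/-- The Sumudu transform of `f : [0,∞) → ℝ`: `S[f](u) = ∫₀^∞ f(t·u)·e^{−t} dt`. -/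
noncomputable def sumudu (f : ℝ → ℝ) (u : ℝ) : ℝ :=
  ∫ t in Set.Ioi (0 : ℝ), f (t * u) * Real.exp (-t)

open Filter Topology in
lemma sumudu_bound (g : ℝ → ℝ) (Q η u : ℝ) (hu : 0 < u)
    (hb : ∀ t ≥ (0 : ℝ), |g t| ≤ Q * Real.exp (t / η)) (t : ℝ) (ht : 0 ≤ t) :
    ‖g (t * u) * Real.exp (-t)‖ ≤ Q * Real.exp (-(1 - u / η) * t) := by
  have h := hb (t * u) (by positivity)
  rw [norm_mul, Real.norm_eq_abs, Real.norm_eq_abs, abs_of_pos (Real.exp_pos _)]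
  calc _ ≤ Q * Real.exp (t * u / η) * Real.exp (-t) := by gcongr
    _ = _ := by
      rw [mul_assoc, ← Real.exp_add]
      congr 2
      ring

lemma sumudu_integrable (g : ℝ → ℝ) (Q η u : ℝ) (hη : 0 < η) (hu : 0 < u) (huη : u < η)
    (hg : ContinuousOn g (Set.Ici 0))
    (hb : ∀ t ≥ (0 : ℝ), |g t| ≤ Q * Real.exp (t / η)) :
    IntegrableOn (fun t => g (t * u) * Real.exp (-t)) (Set.Ioi 0) := by
  have hc : 0 < 1 - u / η := by
    rw [sub_pos, div_lt_one hη]; exact huη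
  have hi : IntegrableOn (fun t => Q * Real.exp (-(1 - u / η) * t)) (Set.Ioi 0) :=
    (exp_neg_integrableOn_Ioi 0 hc).const_mul Q
  refine Integrable.mono' hi ?_ ?_
  · refine ContinuousOn.aestronglyMeasurable ?_ measurableSet_Ioi
    refine ContinuousOn.mul (hg.comp (by fun_prop) ?_) (by fun_prop)
    intro t ht
    exact mul_nonneg (le_of_lt ht) hu.le
  · refine (ae_restrict_mem measurableSet_Ioi).mono fun t ht => ?_
    exact sumudu_bound g Q η u hu hb t (le_of_lt ht)

open Filter Topology in
lemma sumudu_step (g g' : ℝ → ℝ) (Q η u : ℝ) (hη : 0 < η) (hu : 0 < u) (huη : u < η)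
    (hg : ContinuousOn g (Set.Ici 0)) (hg' : ContinuousOn g' (Set.Ici 0))
    (hd : ∀ x ∈ Set.Ioi (0 : ℝ), HasDerivAt g (g' x) x)
    (hb : ∀ t ≥ (0 : ℝ), |g t| ≤ Q * Real.exp (t / η))
    (hb' : ∀ t ≥ (0 : ℝ), |g' t| ≤ Q * Real.exp (t / η)) :
    u * sumudu g' u = sumudu g u - g 0 := by
  have hc : 0 < 1 - u / η := by
    rw [sub_pos, div_lt_one hη]; exact huη
  have i1 := sumudu_integrable g Q η u hη hu huη hg hb
  have i2 := (sumudu_integrable g' Q η u hη hu huη hg' hb').const_mul u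
  have key := integral_Ioi_of_hasDerivAt_of_tendsto (a := 0) (m := (0:ℝ))
    (f := fun t => g (t * u) * Real.exp (-t))
    (f' := fun t => u * (g' (t * u) * Real.exp (-t)) - g (t * u) * Real.exp (-t))
    ?_ ?_ (i2.sub i1) ?_
  · rw [integral_sub i2 i1, integral_const_mul] at key
    simp only [zero_mul, neg_zero, Real.exp_zero, mul_one] at key
    unfold sumudu
    linarith
  · have : ContinuousOn (fun t => g (t * u) * Real.exp (-t)) (Set.Ici 0) := by
      refine ContinuousOn.mul (hg.comp (by fun_prop) ?_) (by fun_prop)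
      intro t ht
      exact mul_nonneg ht hu.le
    exact this 0 Set.self_mem_Ici
  · intro x hx
    have h1 : HasDerivAt (fun t : ℝ => t * u) u x := by
      simpa using (hasDerivAt_id x).mul_const u
    have h2 := (hd (x * u) (mul_pos hx hu)).comp x h1
    have h3 : HasDerivAt (fun t : ℝ => Real.exp (-t)) (-Real.exp (-x)) x := by
      simpa using (hasDerivAt_neg x).exp
    refine (h2.mul h3).congr_deriv ?_
    simp only [Function.comp]
    ring
  · have h0 : Tendsto (fun t => Q * Real.exp (-(1 - u / η) * t)) atTop (𝓝 0) := by
      have : Tendsto (fun t => -(1 - u / η) * t) atTop atBot :=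
        tendsto_id.const_mul_atTop_of_neg (by linarith)
      simpa using (Real.tendsto_exp_atBot.comp this).const_mul Q
    refine squeeze_zero_norm' ?_ h0
    filter_upwards [eventually_ge_atTop 0] with t ht
    exact sumudu_bound g Q η u hu hb t ht

theorem sumudu_iteratedDeriv (n : ℕ) (hn : 1 ≤ n) (f : ℝ → ℝ) (Q η : ℝ)
    (hQ : 0 < Q) (hη : 0 < η)
    (hf : ContDiffOn ℝ n f (Set.Ici 0))
    (hbound : ∀ i ≤ n, ∀ t ≥ (0 : ℝ),
      |iteratedDerivWithin i f (Set.Ici 0) t| ≤ Q * Real.exp (t / η)) :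
    ∀ u : ℝ, 0 < u → u < η →
      sumudu (iteratedDerivWithin n f (Set.Ici 0)) u =
        (u : ℝ) ^ (-(n : ℤ)) *
          (sumudu f u - ∑ i ∈ Finset.range n, u ^ i * iteratedDerivWithin i f (Set.Ici 0) 0) := by
  intro u hu huη
  have hU : UniqueDiffOn ℝ (Set.Ici (0 : ℝ)) := uniqueDiffOn_Ici 0
  have main : ∀ k ≤ n, u ^ k * sumudu (iteratedDerivWithin k f (Set.Ici 0)) u =
      sumudu f u - ∑ i ∈ Finset.range k, u ^ i * iteratedDerivWithin i f (Set.Ici 0) 0 := by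
    intro k
    induction k with
    | zero => intro _; simp [iteratedDerivWithin_zero]
    | succ k ih =>
      intro hk
      have hs := sumudu_step (iteratedDerivWithin k f (Set.Ici 0))
        (iteratedDerivWithin (k + 1) f (Set.Ici 0)) Q η u hη hu huη
        (hf.continuousOn_iteratedDerivWithin (by exact_mod_cast (by omega : k ≤ n)) hU)
        (hf.continuousOn_iteratedDerivWithin (by exact_mod_cast hk) hU)
        (by
          intro x hx
          have hdiff := hf.differentiableOn_iteratedDerivWithin (m := k)
            (by exact_mod_cast hk) hU x (Set.mem_Ici.2 (le_of_lt hx))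
          rw [iteratedDerivWithin_succ]
          exact hdiff.hasDerivWithinAt.hasDerivAt (Ici_mem_nhds hx))
        (hbound k (by omega)) (hbound (k + 1) hk)
      rw [Finset.sum_range_succ, pow_succ, mul_assoc, hs, mul_sub, ih (by omega)]
      ring
  rw [← main n le_rfl, zpow_neg, zpow_natCast, ← mul_assoc,
    inv_mul_cancel₀ (pow_ne_zero _ hu.ne'), one_mul]
end

section
/- Let 0 < α < 1 and let f : [0,∞) → ℝ be continuously differentiable, with constants Q > 0 and η > 0 such that |f(t)| ≤ Q·exp(t/η) and |f'(t)| ≤ Q·exp(t/η) for all t ≥ 0. Then there exists η' > 0 such that for every u with 0 < u < η', the Sumudu transform of the Caputo fractional derivative of f of order α satisfies S[{}^C D^α f](u) = u^{−α}·(S[f](u) − f(0)). -/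
open MeasureTheory Real Set

/-- The Caputo fractional derivative of order `α`:
`({}^C D^α f)(t) = (1/Γ(1−α)) · ∫₀^t (t−η)^{−α} · f'(η) dη`. -/
noncomputable def caputo (α : ℝ) (f : ℝ → ℝ) (t : ℝ) : ℝ :=
  (1 / Real.Gamma (1 - α)) * ∫ s in (0 : ℝ)..t, (t - s) ^ (-α) * deriv f s


theorem sumudu_eq_laplace (g : ℝ → ℝ) (u : ℝ) (hu : 0 < u) :
    sumudu g u = u⁻¹ * ∫ x in Set.Ioi (0 : ℝ), g x * Real.exp (-(u⁻¹ * x)) := by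
  have h := MeasureTheory.integral_comp_mul_right_Ioi
    (fun x => g x * Real.exp (-(u⁻¹ * x))) 0 hu
  rw [zero_mul, smul_eq_mul] at h
  rw [← h, sumudu]
  congr 1
  ext t
  have : u⁻¹ * (t * u) = t := by field_simp
  rw [this]

theorem integrable_of_exp_bound (g : ℝ → ℝ) (Q η u : ℝ) (hu : 0 < u) (huη : u < η)
    (hm : AEStronglyMeasurable g (volume.restrict (Set.Ioi 0)))
    (hb : ∀ t ≥ (0 : ℝ), |g t| ≤ Q * Real.exp (t / η)) :
    IntegrableOn (fun x => g x * Real.exp (-(u⁻¹ * x))) (Set.Ioi 0) := by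
  have hlt : 0 < u⁻¹ - η⁻¹ := sub_pos.2 (inv_strictAnti₀ hu huη)
  have h := (exp_neg_integrableOn_Ioi 0 hlt).const_mul Q
  refine Integrable.mono' h (hm.mul (by fun_prop)) ?_
  refine (ae_restrict_iff' measurableSet_Ioi).mpr (ae_of_all _ fun x hx => ?_)
  have hx' : (0 : ℝ) ≤ x := le_of_lt hx
  rw [norm_mul, Real.norm_eq_abs, Real.norm_eq_abs, Real.abs_exp]
  calc |g x| * Real.exp (-(u⁻¹ * x)) ≤ Q * Real.exp (x / η) * Real.exp (-(u⁻¹ * x)) := by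
        gcongr; exact hb x hx'
    _ = Q * Real.exp (-(u⁻¹ - η⁻¹) * x) := by
        rw [mul_assoc, ← Real.exp_add]; congr 2; ring

theorem laplace_deriv (f : ℝ → ℝ) (Q η u : ℝ) (hu : 0 < u) (huη : u < η)
    (hf : ContDiffOn ℝ 1 f (Set.Ici 0))
    (hbound : ∀ t ≥ (0 : ℝ), |f t| ≤ Q * Real.exp (t / η))
    (hbound' : ∀ t ≥ (0 : ℝ), |deriv f t| ≤ Q * Real.exp (t / η)) :
    ∫ x in Set.Ioi (0 : ℝ), deriv f x * Real.exp (-(u⁻¹ * x)) = sumudu f u - f 0 := by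
  have i1 := integrable_of_exp_bound f Q η u hu huη
    ((hf.continuousOn.mono Ioi_subset_Ici_self).aestronglyMeasurable measurableSet_Ioi) hbound
  have i2 := integrable_of_exp_bound (deriv f) Q η u hu huη
    (measurable_deriv f).aestronglyMeasurable hbound'
  have hlt : 0 < u⁻¹ - η⁻¹ := sub_pos.2 (inv_strictAnti₀ hu huη)
  have key := integral_Ioi_of_hasDerivAt_of_tendsto (a := 0) (m := 0)
    (f := fun x => f x * Real.exp (-(u⁻¹ * x)))
    (f' := fun x => deriv f x * Real.exp (-(u⁻¹ * x)) - u⁻¹ * (f x * Real.exp (-(u⁻¹ * x))))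
    ?_ ?_ (i2.sub (i1.const_mul _)) ?_
  · rw [integral_sub i2 (i1.const_mul _), integral_const_mul, ← sumudu_eq_laplace f u hu] at key
    simp at key
    linarith
  · exact (hf.continuousOn 0 self_mem_Ici).mul (by fun_prop)
  · intro x hx
    have hd : HasDerivAt f (deriv f x) x :=
      ((hf.differentiableOn one_ne_zero).differentiableAt (Ici_mem_nhds hx)).hasDerivAt
    have he : HasDerivAt (fun x => Real.exp (-(u⁻¹ * x))) (Real.exp (-(u⁻¹ * x)) * (-(u⁻¹ * 1))) x :=
      ((hasDerivAt_id x).const_mul u⁻¹).neg.exp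
    exact (hd.mul he).congr_deriv (by ring)
  · have ht : Filter.Tendsto (fun x => Q * Real.exp (-(u⁻¹ - η⁻¹) * x)) Filter.atTop (nhds 0) := by
      have := (Real.tendsto_exp_atBot.comp
        (Filter.tendsto_id.const_mul_atTop_of_neg (neg_neg_iff_pos.2 hlt))).const_mul Q
      simpa using this
    refine squeeze_zero_norm' ?_ ht
    filter_upwards [Filter.eventually_ge_atTop 0] with x hx
    rw [norm_mul, Real.norm_eq_abs, Real.norm_eq_abs, Real.abs_exp]
    calc |f x| * Real.exp (-(u⁻¹ * x)) ≤ Q * Real.exp (x / η) * Real.exp (-(u⁻¹ * x)) := by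
          gcongr; exact hbound x hx
      _ = Q * Real.exp (-(u⁻¹ - η⁻¹) * x) := by
          rw [mul_assoc, ← Real.exp_add]; congr 2; ring

theorem sumudu_caputo (α : ℝ) (hα0 : 0 < α) (hα1 : α < 1) (f : ℝ → ℝ) (Q η : ℝ)
    (hQ : 0 < Q) (hη : 0 < η)
    (hf : ContDiffOn ℝ 1 f (Set.Ici 0))
    (hbound : ∀ t ≥ (0 : ℝ), |f t| ≤ Q * Real.exp (t / η))
    (hbound' : ∀ t ≥ (0 : ℝ), |deriv f t| ≤ Q * Real.exp (t / η)) :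
    ∃ η' > (0 : ℝ), ∀ u : ℝ, 0 < u → u < η' →
      sumudu (caputo α f) u = u ^ (-α) * (sumudu f u - f 0) := by
  refine ⟨η, hη, fun u hu huη => ?_⟩
  have i2 := integrable_of_exp_bound (deriv f) Q η u hu huη
    (measurable_deriv f).aestronglyMeasurable hbound'
  have hu' : 0 < u⁻¹ := inv_pos.2 hu
  have hG : 0 < Real.Gamma (1 - α) := Real.Gamma_pos_of_pos (by linarith)
  have hg := Real.integral_rpow_mul_exp_neg_mul_Ioi (a := 1 - α) (by linarith) hu'
  rw [show 1 - α - 1 = -α by ring, one_div, inv_inv] at hg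
  have ig : IntegrableOn (fun x : ℝ => x ^ (-α) * Real.exp (-(u⁻¹ * x))) (Set.Ioi 0) :=
    .of_integral_ne_zero (by rw [hg]; positivity)
  have conv := integral_posConvolution i2 ig (ContinuousLinearMap.mul ℝ ℝ)
  simp_rw [ContinuousLinearMap.mul_apply'] at conv
  rw [hg, laplace_deriv f Q η u hu huη hf hbound hbound'] at conv
  have hc : ∀ x : ℝ, caputo α f x * Real.exp (-(u⁻¹ * x)) = (1 / Real.Gamma (1 - α)) *
      ∫ t in (0 : ℝ)..x, deriv f t * Real.exp (-(u⁻¹ * t)) *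
        ((x - t) ^ (-α) * Real.exp (-(u⁻¹ * (x - t)))) := by
    intro x
    rw [caputo, mul_assoc, ← intervalIntegral.integral_mul_const]
    congr 2
    ext t
    have : Real.exp (-(u⁻¹ * x)) = Real.exp (-(u⁻¹ * t)) * Real.exp (-(u⁻¹ * (x - t))) := by
      rw [← Real.exp_add]; congr 1; ring
    rw [this]; ring
  rw [sumudu_eq_laplace _ u hu]
  simp_rw [hc]
  rw [integral_const_mul, conv, show (1 : ℝ) - α = -α + 1 by ring, Real.rpow_add_one hu.ne']
  rw [show (1 : ℝ) - α = -α + 1 by ring] at hG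
  field_simp
end

section
/- Let α > 0, a > 0 and u > 0 satisfy a·u^α < 1. Then the Sumudu transform of the function t ↦ E_α(−a·t^α) on [0,∞) satisfies S[t ↦ E_α(−a·t^α)](u) = 1/(1 + a·u^α). -/
open MeasureTheory Real Set

/-- The Mittag-Leffler function `E_α(t) = Σ_{n=0}^∞ t^n / Γ(α·n + 1)`. -/
noncomputable def mittagLeffler (α t : ℝ) : ℝ :=
  ∑' n : ℕ, t ^ n / Real.Gamma (α * n + 1)

theorem sumudu_mittagLeffler (α a u : ℝ) (hα : 0 < α) (ha : 0 < a) (hu : 0 < u)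
    (h : a * u ^ α < 1) :
    sumudu (fun t => mittagLeffler α (-(a * t ^ α))) u = 1 / (1 + a * u ^ α) := by
  have hx0 : 0 < a * u ^ α := mul_pos ha (rpow_pos_of_pos hu α)
  set x : ℝ := a * u ^ α with hx
  have hs : ∀ n : ℕ, 0 < α * n + 1 := fun n => by positivity
  have hG : ∀ n : ℕ, 0 < Real.Gamma (α * n + 1) := fun n => Real.Gamma_pos_of_pos (hs n)
  let F : ℕ → ℝ → ℝ := fun n t =>
    (Real.exp (-t) * t ^ ((α * n + 1) - 1)) * ((-x) ^ n / Real.Gamma (α * n + 1))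
  have hFint : ∀ n, Integrable (F n) (volume.restrict (Ioi 0)) := fun n =>
    (Real.GammaIntegral_convergent (hs n)).mul_const _
  have hF : ∀ n, ∫ t in Ioi (0 : ℝ), F n t = (-x) ^ n := fun n => by
    simp only [F]
    rw [integral_mul_const, ← Real.Gamma_eq_integral (hs n), mul_div_cancel₀ _ (hG n).ne']
  have hFn : ∀ n, ∫ t in Ioi (0 : ℝ), ‖F n t‖ = x ^ n := fun n => by
    have : ∫ t in Ioi (0 : ℝ), ‖F n t‖ = ∫ t in Ioi (0 : ℝ),
        (Real.exp (-t) * t ^ ((α * n + 1) - 1)) * (x ^ n / Real.Gamma (α * n + 1)) := by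
      refine setIntegral_congr_fun measurableSet_Ioi fun t ht => ?_
      have ht0 : 0 < t := ht
      simp only [F]
      rw [norm_mul, norm_div, norm_pow, norm_neg, Real.norm_of_nonneg hx0.le,
        Real.norm_of_nonneg (hG n).le, Real.norm_of_nonneg (by positivity)]
    rw [this, integral_mul_const, ← Real.Gamma_eq_integral (hs n), mul_div_cancel₀ _ (hG n).ne']
  have hsum : Summable fun n => ∫ t in Ioi (0 : ℝ), ‖F n t‖ := by
    simp only [hFn]
    exact summable_geometric_of_lt_one hx0.le h
  have key := integral_tsum_of_summable_integral_norm hFint hsum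
  simp only [hF] at key
  rw [tsum_geometric_of_norm_lt_one (by rw [norm_neg, Real.norm_of_nonneg hx0.le]; exact h)] at key
  rw [one_div, ← sub_neg_eq_add, key]
  unfold sumudu mittagLeffler
  refine setIntegral_congr_fun measurableSet_Ioi fun t ht => ?_
  have ht0 : 0 < t := ht
  simp only [F]
  rw [← tsum_mul_right]
  refine tsum_congr fun n => ?_
  have e : -(a * (t * u) ^ α) = t ^ α * (-x) := by
    rw [Real.mul_rpow ht0.le hu.le, hx]; ring
  rw [e, mul_pow, add_sub_cancel_right, Real.rpow_mul ht0.le, Real.rpow_natCast]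
  ring
end

section
/- Let α > 0, a > 0 and u > 0 satisfy a·u^α < 1. Then the Sumudu transform of the function t ↦ 1 − E_α(−a·t^α) on [0,∞) satisfies S[t ↦ 1 − E_α(−a·t^α)](u) = a·u^α/(1 + a·u^α). -/
open MeasureTheory Real Set

theorem sumudu_one_sub_mittagLeffler (α a u : ℝ) (hα : 0 < α) (ha : 0 < a) (hu : 0 < u)
    (h : a * u ^ α < 1) :
    sumudu (fun t => 1 - mittagLeffler α (-(a * t ^ α))) u =
      a * u ^ α / (1 + a * u ^ α) := by
  set c := a * u ^ α with hc
  have hc0 : 0 < c := by positivity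
  have hpos : ∀ n : ℕ, 0 < α * n + 1 := fun n => by positivity
  have hG : ∀ n : ℕ, 0 < Real.Gamma (α * n + 1) := fun n => Real.Gamma_pos_of_pos (hpos n)
  let F : ℕ → ℝ → ℝ := fun n t =>
    ((-c) ^ n / Real.Gamma (α * n + 1)) * (Real.exp (-t) * t ^ (α * n + 1 - 1))
  have hFint : ∀ n, Integrable (F n) (volume.restrict (Ioi 0)) := fun n =>
    (Real.GammaIntegral_convergent (hpos n)).const_mul _
  have hFval : ∀ n, ∫ t in Ioi (0 : ℝ), F n t = (-c) ^ n := fun n => by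
    simp only [F]
    rw [integral_const_mul, ← Real.Gamma_eq_integral (hpos n)]
    exact div_mul_cancel₀ _ (hG n).ne'
  have hFnorm : ∀ n, ∫ t in Ioi (0 : ℝ), ‖F n t‖ = c ^ n := fun n => by
    have : ∫ t in Ioi (0 : ℝ), ‖F n t‖ = ∫ t in Ioi (0 : ℝ),
        (c ^ n / Real.Gamma (α * n + 1)) * (Real.exp (-t) * t ^ (α * n + 1 - 1)) := by
      refine setIntegral_congr_fun measurableSet_Ioi fun t ht => ?_
      have ht : 0 < t := ht
      simp only [F, norm_mul, norm_div, norm_pow, norm_neg, Real.norm_eq_abs]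
      rw [abs_of_pos hc0, abs_of_pos (hG n), abs_of_pos (Real.exp_pos _),
        abs_of_pos (Real.rpow_pos_of_pos ht _)]
    rw [this, integral_const_mul, ← Real.Gamma_eq_integral (hpos n)]
    exact div_mul_cancel₀ _ (hG n).ne'
  have hsum : Summable fun n => ∫ t in Ioi (0 : ℝ), ‖F n t‖ := by
    simp only [hFnorm]
    exact summable_geometric_of_lt_one hc0.le h
  have hS := hasSum_integral_of_summable_integral_norm hFint hsum
  simp only [hFval] at hS
  have hval : ∫ t in Ioi (0 : ℝ), ∑' n, F n t = (1 + c)⁻¹ := by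
    have := hasSum_geometric_of_abs_lt_one (r := -c) (by rwa [abs_neg, abs_of_pos hc0])
    rw [sub_neg_eq_add] at this
    exact hS.unique this
  have hint : Integrable (fun t => ∑' n, F n t) (volume.restrict (Ioi 0)) := by
    by_contra hn
    rw [integral_undef hn] at hval
    have : (0 : ℝ) < (1 + c)⁻¹ := by positivity
    exact this.ne hval
  have hexp : Integrable (fun t : ℝ => Real.exp (-t)) (volume.restrict (Ioi 0)) :=
    integrableOn_exp_neg_Ioi 0
  have key : sumudu (fun t => 1 - mittagLeffler α (-(a * t ^ α))) u =
      ∫ t in Ioi (0 : ℝ), (Real.exp (-t) - ∑' n, F n t) := by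
    unfold sumudu
    refine setIntegral_congr_fun measurableSet_Ioi fun t ht => ?_
    have ht : 0 < t := ht
    simp only [mittagLeffler]
    rw [sub_mul, one_mul, ← tsum_mul_right]
    congr 1
    refine tsum_congr fun n => ?_
    simp only [F]
    rw [add_sub_cancel_right, Real.rpow_mul ht.le, Real.rpow_natCast,
      Real.mul_rpow ht.le hu.le, hc,
      show -(a * (t ^ α * u ^ α)) = -(a * u ^ α) * t ^ α by ring, mul_pow]
    ring
  rw [key, integral_sub hexp hint, hval, integral_exp_neg_Ioi_zero]
  field_simp
  ring
end

section
/- Let p > 0, q > 0, 0 < μ < 1 and k₀ > 0. Define k : [0,∞) → ℝ by k(t) = ( p/q + (k₀^{1−μ} − p/q)·exp(−q·(1−μ)·t) )^{1/(1−μ)}. Then k(t) > 0 for all t ≥ 0, k(0) = k₀, k is differentiable on [0,∞), and k'(t) = p·k(t)^μ − q·k(t) for all t ≥ 0; that is, k solves the Solow–Swan initial value problem. -/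
open Real Set

theorem solowSwan_solution (p q μ k₀ : ℝ) (hp : 0 < p) (hq : 0 < q)
    (hμ0 : 0 < μ) (hμ1 : μ < 1) (hk₀ : 0 < k₀)
    (k : ℝ → ℝ)
    (hk : ∀ t : ℝ, k t =
      (p / q + (k₀ ^ (1 - μ) - p / q) * Real.exp (-q * (1 - μ) * t)) ^ (1 / (1 - μ))) :
    (∀ t ≥ (0 : ℝ), 0 < k t) ∧
    k 0 = k₀ ∧
    (∀ t ≥ (0 : ℝ), HasDerivWithinAt k (p * k t ^ μ - q * k t) (Set.Ici 0) t) := by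
  have h1 : 0 < 1 - μ := by linarith
  have hB : ∀ t ≥ (0 : ℝ),
      0 < p / q + (k₀ ^ (1 - μ) - p / q) * Real.exp (-q * (1 - μ) * t) := by
    intro t ht
    have he : Real.exp (-q * (1 - μ) * t) ≤ 1 := by
      rw [Real.exp_le_one_iff]
      have : 0 ≤ q * (1 - μ) * t := by positivity
      linarith
    have h2 : 0 < k₀ ^ (1 - μ) * Real.exp (-q * (1 - μ) * t) := by positivity
    have h3 : 0 ≤ p / q * (1 - Real.exp (-q * (1 - μ) * t)) :=
      mul_nonneg (by positivity) (by linarith)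
    linarith
  refine ⟨fun t ht => ?_, ?_, fun t ht => ?_⟩
  · rw [hk]
    exact Real.rpow_pos_of_pos (hB t ht) _
  · rw [hk]
    simp only [mul_zero, Real.exp_zero, mul_one, add_sub_cancel]
    rw [← Real.rpow_mul hk₀.le, mul_one_div_cancel h1.ne', Real.rpow_one]
  · have hd : HasDerivAt
        (fun t : ℝ => p / q + (k₀ ^ (1 - μ) - p / q) * Real.exp (-q * (1 - μ) * t))
        ((k₀ ^ (1 - μ) - p / q) * (Real.exp (-q * (1 - μ) * t) * (-q * (1 - μ) * 1))) t :=
      ((((hasDerivAt_id' t).const_mul (-q * (1 - μ))).exp).const_mul _).const_add _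
    have hr := hd.rpow_const (p := 1 / (1 - μ)) (Or.inl (hB t ht).ne')
    have hfun : k = fun t : ℝ =>
      (p / q + (k₀ ^ (1 - μ) - p / q) * Real.exp (-q * (1 - μ) * t)) ^ (1 / (1 - μ)) :=
      funext hk
    rw [← hfun] at hr
    refine HasDerivAt.hasDerivWithinAt ?_
    refine hr.congr_deriv ?_
    symm
    rw [hk t]
    have hBt := hB t ht
    set E := Real.exp (-q * (1 - μ) * t)
    set A := k₀ ^ (1 - μ)
    obtain ⟨B, hBe⟩ : ∃ B, B = p / q + (A - p / q) * E := ⟨_, rfl⟩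
    rw [← hBe] at hBt ⊢
    have e1 : (B ^ (1 / (1 - μ))) ^ μ = B ^ (1 / (1 - μ) - 1) := by
      rw [← Real.rpow_mul hBt.le]
      congr 1
      field_simp
      ring
    have e2 : B ^ (1 / (1 - μ)) = B ^ (1 / (1 - μ) - 1) * B := by
      rw [← Real.rpow_add_one hBt.ne', sub_add_cancel]
    rw [e1, e2]
    have e3 : (A - p / q) * E = B - p / q := by linarith
    have e4 : (A - p / q) * (E * (-q * (1 - μ) * 1)) * (1 / (1 - μ)) = p - q * B := by
      have : (A - p / q) * (E * (-q * (1 - μ) * 1)) * (1 / (1 - μ))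
          = ((A - p / q) * E) * (-q) * ((1 - μ) * (1 / (1 - μ))) := by ring
      rw [this, e3, mul_one_div_cancel h1.ne']
      field_simp
      ring
    rw [e4]
    ring
end

section
/- Let p > 0, q > 0, 0 < μ < 1 and k₀ > 0, and let k(t) = ( p/q + (k₀^{1−μ} − p/q)·exp(−q·(1−μ)·t) )^{1/(1−μ)} be the solution of the Solow–Swan initial value problem. Then k(t) tends to the nonzero equilibrium (p/q)^{1/(1−μ)} as t → ∞. -/
open Real Set Filter

theorem solowSwan_convergence (p q μ k₀ : ℝ) (hp : 0 < p) (hq : 0 < q)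
    (hμ0 : 0 < μ) (hμ1 : μ < 1) (hk₀ : 0 < k₀)
    (k : ℝ → ℝ)
    (hk : ∀ t : ℝ, k t =
      (p / q + (k₀ ^ (1 - μ) - p / q) * Real.exp (-q * (1 - μ) * t)) ^ (1 / (1 - μ))) :
    Filter.Tendsto k Filter.atTop (nhds ((p / q) ^ (1 / (1 - μ)))) := by
  have hc : -q * (1 - μ) < 0 := by nlinarith
  have hpq : p / q ≠ 0 := (div_pos hp hq).ne'
  have h1 : Tendsto (fun t : ℝ => Real.exp (-q * (1 - μ) * t)) atTop (nhds 0) :=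
    Real.tendsto_exp_atBot.comp (tendsto_id.const_mul_atTop_of_neg hc)
  have h2 : Tendsto (fun t : ℝ => p / q + (k₀ ^ (1 - μ) - p / q) *
      Real.exp (-q * (1 - μ) * t)) atTop (nhds (p / q)) := by
    simpa using (h1.const_mul (k₀ ^ (1 - μ) - p / q)).const_add (p / q)
  rw [funext hk]
  exact h2.rpow_const (Or.inl hpq)
end

section
/- Let p > 0, q > 0, 0 < μ < 1, k₀ > 0, and set k* = (p/q)^{1/(1−μ)}. Let k(t) = ( p/q + (k₀^{1−μ} − p/q)·exp(−q·(1−μ)·t) )^{1/(1−μ)} be the solution of the Solow–Swan initial value problem. If 0 < k₀ < k*, then k is strictly increasing on [0,∞) and k(t) < k* for all t ≥ 0; if k₀ > k*, then k is strictly decreasing on [0,∞) and k(t) > k* for all t ≥ 0; if k₀ = k*, then k is constant equal to k*. -/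
open Real Set

theorem solowSwan_monotonicity (p q μ k₀ : ℝ) (hp : 0 < p) (hq : 0 < q)
    (hμ0 : 0 < μ) (hμ1 : μ < 1) (hk₀ : 0 < k₀)
    (kstar : ℝ) (hkstar : kstar = (p / q) ^ (1 / (1 - μ)))
    (k : ℝ → ℝ)
    (hk : ∀ t : ℝ, k t =
      (p / q + (k₀ ^ (1 - μ) - p / q) * Real.exp (-q * (1 - μ) * t)) ^ (1 / (1 - μ))) :
    (k₀ < kstar → StrictMonoOn k (Set.Ici 0) ∧ ∀ t ≥ (0 : ℝ), k t < kstar) ∧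
    (kstar < k₀ → StrictAntiOn k (Set.Ici 0) ∧ ∀ t ≥ (0 : ℝ), kstar < k t) ∧
    (k₀ = kstar → ∀ t ≥ (0 : ℝ), k t = kstar) := by
  have hm : 0 < 1 - μ := by linarith
  have hr : 0 < 1 / (1 - μ) := by positivity
  have hA : 0 < p / q := by positivity
  have hks : 0 < kstar := by rw [hkstar]; positivity
  have hkA : kstar ^ (1 - μ) = p / q := by
    rw [hkstar, ← Real.rpow_mul hA.le, one_div_mul_cancel hm.ne', Real.rpow_one]
  have hB : 0 < k₀ ^ (1 - μ) := by positivity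
  have he1 : ∀ t : ℝ, 0 ≤ t → Real.exp (-q * (1 - μ) * t) ≤ 1 := by
    intro t ht
    rw [Real.exp_le_one_iff]
    have : 0 ≤ q * (1 - μ) * t := by positivity
    linarith
  have hanti : ∀ s t : ℝ, s < t →
      Real.exp (-q * (1 - μ) * t) < Real.exp (-q * (1 - μ) * s) := by
    intro s t hst
    rw [Real.exp_lt_exp]
    have : 0 < q * (1 - μ) * (t - s) := mul_pos (mul_pos hq hm) (sub_pos.2 hst)
    linarith
  generalize p / q = A at *
  have hpos : ∀ t : ℝ, 0 ≤ t →
      0 < A + (k₀ ^ (1 - μ) - A) * Real.exp (-q * (1 - μ) * t) := by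
    intro t ht
    have h1 := mul_nonneg hA.le (sub_nonneg.2 (he1 t ht))
    have h2 := mul_pos hB (Real.exp_pos (-q * (1 - μ) * t))
    linarith
  refine ⟨fun h => ?_, fun h => ?_, fun h => ?_⟩
  · have hBA : k₀ ^ (1 - μ) < A := hkA ▸ Real.rpow_lt_rpow hk₀.le h hm
    refine ⟨fun s hs t ht hst => ?_, fun t ht => ?_⟩
    · rw [hk, hk]
      refine Real.rpow_lt_rpow (hpos s hs).le ?_ hr
      have := mul_lt_mul_of_pos_left (hanti s t hst) (sub_pos.2 hBA)
      linarith
    · rw [hk, hkstar]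
      refine Real.rpow_lt_rpow (hpos t ht).le ?_ hr
      have := mul_pos (sub_pos.2 hBA) (Real.exp_pos (-q * (1 - μ) * t))
      linarith
  · have hBA : A < k₀ ^ (1 - μ) := hkA ▸ Real.rpow_lt_rpow hks.le h hm
    refine ⟨fun s hs t ht hst => ?_, fun t ht => ?_⟩
    · rw [hk, hk]
      refine Real.rpow_lt_rpow (hpos t ht).le ?_ hr
      have := mul_lt_mul_of_pos_left (hanti s t hst) (sub_pos.2 hBA)
      linarith
    · rw [hk, hkstar]
      refine Real.rpow_lt_rpow hA.le ?_ hr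
      have := mul_pos (sub_pos.2 hBA) (Real.exp_pos (-q * (1 - μ) * t))
      linarith
  · intro t ht
    rw [hk, h, hkA, sub_self, zero_mul, add_zero, hkstar]
end
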